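/- arXiv:1911.06275 — 3 statements merged into one kernel-verified Lean document; each statement's English description precedes it below -/
import Mathlib

section
/- For every integer k >= 2, there exists an integer n_k such that for all n >= n_k with n ≡ 0 or 1 (mod 3), there exists a k-chromatic 3-star system of order n. -/
structure EStar (n e : ℕ) where
  centre : Fin n
  leaves : Finset (Fin n)
  card_leaves : leaves.card = e
  centre_not_leaf : centre ∉ leaves

instance {n e : ℕ} : DecidableEq (EStar n e) := fun a b =>
  decidable_of_iff (a.centre = b.centre ∧ a.leaves = b.leaves)
    (by cases a; cases b; simp)

/-- The edge set of an `e`-star: all edges joining the centre to a leaf. -/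
def EStar.edges {n e : ℕ} (S : EStar n e) : Finset (Sym2 (Fin n)) :=
  S.leaves.image (fun a => s(S.centre, a))

/-- The vertex set of an `e`-star. -/
def EStar.verts {n e : ℕ} (S : EStar n e) : Finset (Fin n) :=
  insert S.centre S.leaves

/-- An `e`-star system of order `n`: a collection of `e`-stars whose edge sets
partition the edge set of the complete graph `K_n`. -/
structure EStarSystem (n e : ℕ) where
  stars : Finset (EStar n e)
  partition : ∀ p : Sym2 (Fin n), ¬ p.IsDiag →
    ∃! S, S ∈ stars ∧ p ∈ EStar.edges S

/-- A weak colouring: no star of the system has all of its vertices one colour. -/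
def IsWeakColouring {n e k : ℕ} (sys : EStarSystem n e) (c : Fin n → Fin k) : Prop :=
  ∀ S ∈ sys.stars, ∃ a ∈ S.leaves, c a ≠ c S.centre

def Colourable {n e : ℕ} (sys : EStarSystem n e) (k : ℕ) : Prop :=
  ∃ c : Fin n → Fin k, IsWeakColouring sys c

def Chromatic {n e : ℕ} (sys : EStarSystem n e) (k : ℕ) : Prop :=
  Colourable sys k ∧ ¬ Colourable sys (k - 1)

/-- The size of the colour class of colour `i`. -/
def classCard {n k : ℕ} (c : Fin n → Fin k) (i : Fin k) : ℕ :=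
  (Finset.univ.filter (fun v => c v = i)).card

def UniquelyColourable {n e : ℕ} (sys : EStarSystem n e) (k : ℕ) : Prop :=
  ∀ c₁ c₂ : Fin n → Fin k, IsWeakColouring sys c₁ → IsWeakColouring sys c₂ →
    ∃ π : Equiv.Perm (Fin k), c₂ = π ∘ c₁

/-! ### Star systems on initial segments of `ℕ` -/

/-- A finite family of stars on natural numbers, each given by its centre and its leaves. -/
abbrev StarFamily := Finset (ℕ × Finset ℕ)

/-- The star `s` contains the edge joining `x` and `y`. -/
def StarCovers (s : ℕ × Finset ℕ) (x y : ℕ) : Prop :=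
  (s.1 = x ∧ y ∈ s.2) ∨ (s.1 = y ∧ x ∈ s.2)

/-- `B` is a 3-star system on the vertex set `{0, …, n - 1}`. -/
structure IsThreeStarSystem (n : ℕ) (B : StarFamily) : Prop where
  centre_lt : ∀ s ∈ B, s.1 < n
  leaves_lt : ∀ s ∈ B, ∀ x ∈ s.2, x < n
  card_leaves : ∀ s ∈ B, s.2.card = 3
  centre_not_leaf : ∀ s ∈ B, s.1 ∉ s.2
  exists_cover : ∀ y < n, ∀ x < y, ∃ s ∈ B, StarCovers s x y
  cover_unique : ∀ y < n, ∀ x < y, ∀ s ∈ B, ∀ t ∈ B, StarCovers s x y → StarCovers t x y → s = t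

/-- No star of `B` is monochromatic under `c`. -/
def IsProper {k : ℕ} (B : StarFamily) (c : ℕ → Fin k) : Prop :=
  ∀ s ∈ B, ∃ a ∈ s.2, c a ≠ c s.1

theorem IsProper.mono {k : ℕ} {B C : StarFamily} {c : ℕ → Fin k} (h : IsProper C c) (hBC : B ⊆ C) :
    IsProper B c := fun s hs => h s (hBC hs)

/-- Pairwise disjoint triples of vertices in `{2, …, n - 1}`. -/
structure IsTripleFamily (n : ℕ) (F : Finset (Finset ℕ)) : Prop where
  two_le : ∀ T ∈ F, ∀ x ∈ T, 2 ≤ x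
  lt : ∀ T ∈ F, ∀ x ∈ T, x < n
  card : ∀ T ∈ F, T.card = 3
  disjoint : ∀ T ∈ F, ∀ U ∈ F, ∀ x ∈ T, x ∈ U → T = U

theorem IsTripleFamily.mono {m n : ℕ} {F : Finset (Finset ℕ)} (h : IsTripleFamily m F)
    (hmn : m ≤ n) : IsTripleFamily n F :=
  ⟨h.two_le, fun T hT x hx => (h.lt T hT x hx).trans_le hmn, h.card, h.disjoint⟩

theorem isTripleFamily_empty (n : ℕ) : IsTripleFamily n ∅ := by
  constructor <;> simp

/-- Add the vertices `n`, `n + 1`, `n + 2` to a star system of order `n`. Each new vertex is the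
centre of a star on every triple of `F` and of one star on `0`, `1` and another new vertex; every
remaining old vertex is the centre of a star on the three new vertices. -/
def extendStars (n : ℕ) (B : StarFamily) (F : Finset (Finset ℕ)) : StarFamily :=
  B ∪ ({n, n + 1, n + 2} ×ˢ F) ∪
    {(n, {n + 1, 0, 1}), (n + 1, {n + 2, 0, 1}), (n + 2, {n, 0, 1})} ∪
    ((Finset.Ico 2 n).filter fun v => ∀ T ∈ F, v ∉ T).image fun v => (v, {n, n + 1, n + 2})

theorem mem_extendStars {n : ℕ} {B : StarFamily} {F : Finset (Finset ℕ)} {s : ℕ × Finset ℕ} :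
    s ∈ extendStars n B F ↔ s ∈ B ∨ ((s.1 = n ∨ s.1 = n + 1 ∨ s.1 = n + 2) ∧ s.2 ∈ F) ∨
      (s.1 = n ∧ s.2 = {n + 1, 0, 1}) ∨ (s.1 = n + 1 ∧ s.2 = {n + 2, 0, 1}) ∨
      (s.1 = n + 2 ∧ s.2 = {n, 0, 1}) ∨
      (2 ≤ s.1 ∧ s.1 < n ∧ (∀ T ∈ F, s.1 ∉ T) ∧ s.2 = {n, n + 1, n + 2}) := by
  obtain ⟨a, L⟩ := s
  simp only [extendStars, Finset.mem_union, Finset.mem_product, Finset.mem_insert,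
    Finset.mem_singleton, Finset.mem_image, Finset.mem_filter, Finset.mem_Ico, Prod.mk.injEq]
  grind

theorem subset_extendStars (n : ℕ) (B : StarFamily) (F : Finset (Finset ℕ)) :
    B ⊆ extendStars n B F := fun _ hs => mem_extendStars.2 (Or.inl hs)

theorem IsThreeStarSystem.extendStars {n : ℕ} {B : StarFamily} {F : Finset (Finset ℕ)}
    (hB : IsThreeStarSystem n B) (hn : 2 ≤ n) (hF : IsTripleFamily n F) :
    IsThreeStarSystem (n + 3) (extendStars n B F) := by
  obtain ⟨hB1, hB2, hB3, hB4, hB5, hB6⟩ := hB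
  obtain ⟨hF1, hF2, hF3, hF4⟩ := hF
  constructor
  · intro s hs
    rw [mem_extendStars] at hs
    grind
  · intro s hs x hx
    rw [mem_extendStars] at hs
    rcases hs with h | ⟨h, h2⟩ | ⟨h, h2⟩ | ⟨h, h2⟩ | ⟨h, h2⟩ | ⟨_, h, _, h2⟩
    · have := hB2 s h x hx
      omega
    · have := hF2 _ h2 x hx
      omega
    all_goals
      simp only [h2, Finset.mem_insert, Finset.mem_singleton] at hx
      omega
  · intro s hs
    rw [mem_extendStars] at hs
    rcases hs with h | ⟨h, h2⟩ | ⟨h, h2⟩ | ⟨h, h2⟩ | ⟨h, h2⟩ | ⟨_, h, _, h2⟩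
    · exact hB3 s h
    · exact hF3 _ h2
    all_goals
      rw [h2, Finset.card_eq_three]
      exact ⟨_, _, _, by omega, by omega, by omega, rfl⟩
  · intro s hs hx
    rw [mem_extendStars] at hs
    rcases hs with h | ⟨h, h2⟩ | ⟨h, h2⟩ | ⟨h, h2⟩ | ⟨h, h2⟩ | ⟨_, h, _, h2⟩
    · exact hB4 s h hx
    · have := hF2 _ h2 _ hx
      omega
    all_goals
      simp only [h2, Finset.mem_insert, Finset.mem_singleton] at hx
      omega
  · intro y hy x hxy
    simp only [mem_extendStars]
    by_cases hyn : y < n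
    · obtain ⟨s, hs, h⟩ := hB5 y hyn x hxy
      exact ⟨s, Or.inl hs, h⟩
    by_cases hxn : x < n
    · by_cases hx2 : x < 2
      · obtain rfl | rfl | rfl : y = n ∨ y = n + 1 ∨ y = n + 2 := by omega
        · exact ⟨(y, {y + 1, 0, 1}), by simp, by simp [StarCovers]; omega⟩
        · exact ⟨(n + 1, {n + 2, 0, 1}), by simp, by simp [StarCovers]; omega⟩
        · exact ⟨(n + 2, {n, 0, 1}), by simp, by simp [StarCovers]; omega⟩
      by_cases hT : ∃ T ∈ F, x ∈ T
      · obtain ⟨T, hT, hxT⟩ := hT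
        refine ⟨(y, T), Or.inr (Or.inl ⟨?_, hT⟩), Or.inr ⟨rfl, hxT⟩⟩
        simp only
        omega
      · push Not at hT
        refine ⟨(x, {n, n + 1, n + 2}), ?_, Or.inl ⟨rfl, ?_⟩⟩
        · simp only [not_lt] at hx2
          exact Or.inr (Or.inr (Or.inr (Or.inr (Or.inr ⟨hx2, hxn, hT, rfl⟩))))
        · simp only [Finset.mem_insert, Finset.mem_singleton]
          omega
    · obtain ⟨rfl, rfl⟩ | ⟨rfl, rfl⟩ | ⟨rfl, rfl⟩ :
          (x = n ∧ y = n + 1) ∨ (x = n + 1 ∧ y = n + 2) ∨ (x = n ∧ y = n + 2) := by omega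
      · exact ⟨(x, {x + 1, 0, 1}), by simp, by simp [StarCovers]⟩
      · exact ⟨(n + 1, {n + 2, 0, 1}), by simp, by simp [StarCovers]⟩
      · exact ⟨(x + 2, {x, 0, 1}), by simp, by simp [StarCovers]⟩
  · intro y hy x hxy s hs t ht hsx htx
    rw [mem_extendStars] at hs ht
    have hBst : s ∈ B → t ∈ B → s = t := fun hs ht =>
      hB6 y (by
        rcases hsx with ⟨-, h⟩ | ⟨h, -⟩
        · exact hB2 s hs y h
        · exact h ▸ hB1 s hs) x hxy s hs t ht hsx htx
    have hB' : ∀ r ∈ B, r.1 < n ∧ (x ∈ r.2 → x < n) ∧ (y ∈ r.2 → y < n) := fun r hr =>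
      ⟨hB1 r hr, hB2 r hr x, hB2 r hr y⟩
    have hF' : ∀ T ∈ F, (x ∈ T → 2 ≤ x ∧ x < n) ∧ (y ∈ T → 2 ≤ y ∧ y < n) := fun T hT =>
      ⟨fun h => ⟨hF1 T hT x h, hF2 T hT x h⟩, fun h => ⟨hF1 T hT y h, hF2 T hT y h⟩⟩
    have hFst : s.2 ∈ F → t.2 ∈ F → x ∈ s.2 → x ∈ t.2 → s.2 = t.2 := fun hs ht => hF4 _ hs _ ht x
    have hBs := hB' s
    have hBt := hB' t
    have hFs := hF' s.2
    have hFt := hF' t.2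
    clear hB1 hB2 hB3 hB4 hB5 hB6 hF1 hF2 hF3 hF4 hB' hF'
    unfold StarCovers at hsx htx
    rcases hs with hs | hs | hs | hs | hs | hs <;> rcases ht with ht | ht | ht | ht | ht | ht <;>
      first
      | exact hBst hs ht
      | (apply Prod.ext <;> grind)

/-- A colouring of the old system with one further colour on the new vertices is proper. -/
theorem IsProper.extendStars_newColour {k n : ℕ} {B : StarFamily} {F : Finset (Finset ℕ)}
    {c : ℕ → Fin k} (hc : IsProper B c) (hB : IsThreeStarSystem n B) (hn : 2 ≤ n)
    (hF : IsTripleFamily n F) :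
    IsProper (extendStars n B F) fun v => if v < n then (c v).castSucc else Fin.last k := by
  intro s hs
  have hne : ∀ i : Fin k, i.castSucc ≠ Fin.last k := Fin.castSucc_ne_last
  rw [mem_extendStars] at hs
  rcases hs with h | ⟨h, h2⟩ | ⟨h, h2⟩ | ⟨h, h2⟩ | ⟨h, h2⟩ | ⟨_, h, _, h2⟩
  · obtain ⟨a, ha, hca⟩ := hc s h
    refine ⟨a, ha, ?_⟩
    simpa [hB.leaves_lt s h a ha, hB.centre_lt s h] using hca
  · obtain ⟨a, ha⟩ : s.2.Nonempty := Finset.card_pos.1 (by rw [hF.card _ h2]; norm_num)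
    refine ⟨a, ha, ?_⟩
    have := hF.lt _ h2 a ha
    simp only [this, if_true, show ¬ s.1 < n by omega, if_false]
    exact hne _
  iterate 3
    refine ⟨0, by simp [h2], ?_⟩
    simp only [show 0 < n by omega, if_true, show ¬ s.1 < n by omega, if_false]
    exact hne _
  · refine ⟨n, by simp [h2], ?_⟩
    simp only [h, lt_irrefl, if_true, if_false]
    exact (hne _).symm

/-- With no triples, the extension needs no new colour. -/
theorem IsProper.exists_extendStars_empty {k n : ℕ} (hk : 2 ≤ k) {B : StarFamily}
    {c : ℕ → Fin k} (hc : IsProper B c) (hB : IsThreeStarSystem n B) (hn : 2 ≤ n) :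
    ∃ d : ℕ → Fin k, IsProper (extendStars n B ∅) d := by
  have : Nontrivial (Fin k) := Fin.nontrivial_iff_two_le.2 hk
  obtain ⟨e, he⟩ := exists_ne (c 0)
  let d : ℕ → Fin k := fun v => if v < n then c v else if v = n + 2 then c 0 else e
  have hd0 : d 0 = c 0 := if_pos (by omega)
  have hdn : d n = e := by simp [d]
  have hdn1 : d (n + 1) = e := by simp [d]
  have hdn2 : d (n + 2) = c 0 := by simp [d]
  refine ⟨d, fun s hs => ?_⟩
  rw [mem_extendStars] at hs
  rcases hs with h | ⟨_, h2⟩ | ⟨h, h2⟩ | ⟨h, h2⟩ | ⟨h, h2⟩ | ⟨_, h, _, h2⟩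
  · obtain ⟨a, ha, hca⟩ := hc s h
    refine ⟨a, ha, ?_⟩
    simpa [d, hB.leaves_lt s h a ha, hB.centre_lt s h] using hca
  · simp at h2
  · exact ⟨0, by simp [h2], by rw [h, hd0, hdn]; exact he.symm⟩
  · exact ⟨0, by simp [h2], by rw [h, hd0, hdn1]; exact he.symm⟩
  · exact ⟨n, by simp [h2], by rw [h, hdn, hdn2]; exact he⟩
  · by_cases hs : d s.1 = e
    · exact ⟨n + 2, by simp [h2], by rw [hdn2, hs]; exact he.symm⟩
    · exact ⟨n, by simp [h2], by rw [hdn]; exact Ne.symm hs⟩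

/-! ### Chains of extensions -/

/-- The star family `C` on `m` vertices arises from `B` on `n` vertices by successive extensions. -/
inductive ExtendsTo (n : ℕ) (B : StarFamily) : ℕ → StarFamily → Prop
  | refl : ExtendsTo n B n B
  | step {m : ℕ} {C : StarFamily} {F : Finset (Finset ℕ)} :
      ExtendsTo n B m C → IsTripleFamily m F → ExtendsTo n B (m + 3) (extendStars m C F)

namespace ExtendsTo

variable {n m : ℕ} {B C : StarFamily}

theorem trans {l : ℕ} {D : StarFamily} (h : ExtendsTo n B m C) (h' : ExtendsTo m C l D) :
    ExtendsTo n B l D := by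
  induction h' with
  | refl => exact h
  | step _ hF ih => exact ih.step hF

theorem le (h : ExtendsTo n B m C) : n ≤ m := by
  induction h with
  | refl => exact le_rfl
  | step _ _ ih => omega

theorem mod_three (h : ExtendsTo n B m C) : m % 3 = n % 3 := by
  induction h with
  | refl => rfl
  | step _ _ ih => omega

theorem subset (h : ExtendsTo n B m C) : B ⊆ C := by
  induction h with
  | refl => exact subset_rfl
  | step _ _ ih => exact ih.trans (subset_extendStars _ _ _)

theorem isThreeStarSystem (h : ExtendsTo n B m C) (hB : IsThreeStarSystem n B) (hn : 2 ≤ n) :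
    IsThreeStarSystem m C := by
  induction h with
  | refl => exact hB
  | step h hF ih => exact ih.extendStars (hn.trans h.le) hF

/-- Each extension raises the chromatic number by at most one, so no value is skipped. -/
theorem exists_chromatic {k : ℕ} (h : ExtendsTo n B m C) (hB : IsThreeStarSystem n B) (hn : 2 ≤ n)
    (hcol : ∃ c : ℕ → Fin (k + 1), IsProper B c) (hnot : ¬ ∃ c : ℕ → Fin k, IsProper C c) :
    ∃ l D, ExtendsTo n B l D ∧ (∃ c : ℕ → Fin (k + 1), IsProper D c) ∧
      ¬ ∃ c : ℕ → Fin k, IsProper D c := by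
  induction h with
  | refl => exact ⟨n, B, .refl, hcol, hnot⟩
  | @step l D F h hF ih =>
    by_cases hD : ∃ c : ℕ → Fin k, IsProper D c
    · obtain ⟨c, hc⟩ := hD
      exact ⟨_, _, h.step hF,
        ⟨_, hc.extendStars_newColour (h.isThreeStarSystem hB hn) (hn.trans h.le) hF⟩, hnot⟩
    · exact ih hD

end ExtendsTo

/-! ### Extensions of large chromatic number -/

/-- The vertices in `{2, …, n - 1}` of colour `i`. -/
def colourClass {k : ℕ} (c : ℕ → Fin k) (n : ℕ) (i : Fin k) : Finset ℕ :=
  (Finset.Ico 2 n).filter fun v => c v = i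

/-- The number of vertices in `{2, …, n - 1}`, counting at most three of each colour. -/
def colourSpread {k : ℕ} (c : ℕ → Fin k) (n : ℕ) : ℕ :=
  ∑ i, min 3 (colourClass c n i).card

theorem colourClass_mono {k m n : ℕ} (c : ℕ → Fin k) (h : m ≤ n) (i : Fin k) :
    colourClass c m i ⊆ colourClass c n i :=
  Finset.filter_subset_filter _ (Finset.Ico_subset_Ico_right h)

theorem colourSpread_mono {k : ℕ} (c : ℕ → Fin k) : Monotone (colourSpread c) := fun _ _ h =>
  Finset.sum_le_sum fun i _ => min_le_min_left _ (Finset.card_le_card (colourClass_mono c h i))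

theorem colourSpread_le {k : ℕ} (c : ℕ → Fin k) (n : ℕ) : colourSpread c n ≤ k * 3 := by
  simpa [colourSpread] using
    Finset.sum_le_sum (s := Finset.univ) fun (i : Fin k) _ => min_le_left 3 (colourClass c n i).card

theorem colourSpread_lt {k m n v : ℕ} (c : ℕ → Fin k) (hm : 2 ≤ m) (hmv : m ≤ v) (hvn : v < n)
    (hv : (colourClass c m (c v)).card < 3) : colourSpread c m < colourSpread c n := by
  have hmn : m ≤ n := hmv.trans hvn.le
  refine Finset.sum_lt_sum
    (fun i _ => min_le_min_left _ (Finset.card_le_card (colourClass_mono c hmn i)))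
    ⟨c v, Finset.mem_univ _, ?_⟩
  have : (colourClass c m (c v)).card < (colourClass c n (c v)).card := by
    refine Finset.card_lt_card (Finset.ssubset_iff_subset_ne.2 ⟨colourClass_mono c hmn _, ?_⟩)
    intro h
    have hmem : v ∈ colourClass c n (c v) := by simp [colourClass]; omega
    rw [← h] at hmem
    simp only [colourClass, Finset.mem_filter, Finset.mem_Ico] at hmem
    omega
  omega

/-- A triple family with a monochromatic triple in every colour class of size at least three. -/
theorem exists_monochromatic_triples {k : ℕ} (c : ℕ → Fin k) (n : ℕ) :
    ∃ F, IsTripleFamily n F ∧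
      ∀ i, 3 ≤ (colourClass c n i).card → ∃ T ∈ F, T ⊆ colourClass c n i := by
  have h : ∀ i, ∃ T : Finset ℕ, 3 ≤ (colourClass c n i).card →
      T ⊆ colourClass c n i ∧ T.card = 3 := by
    intro i
    by_cases hi : 3 ≤ (colourClass c n i).card
    · obtain ⟨T, hT⟩ := Finset.exists_subset_card_eq hi
      exact ⟨T, fun _ => hT⟩
    · exact ⟨∅, fun h => absurd h hi⟩
  choose f hf using h
  have hmem : ∀ i, 3 ≤ (colourClass c n i).card → ∀ x ∈ f i, (2 ≤ x ∧ x < n) ∧ c x = i := by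
    intro i hi x hx
    simpa [colourClass] using (hf i hi).1 hx
  refine ⟨(Finset.univ.filter fun i => 3 ≤ (colourClass c n i).card).image f, ?_, ?_⟩
  · constructor <;> simp only [Finset.forall_mem_image, Finset.mem_filter, Finset.mem_univ, true_and]
    · exact fun i hi x hx => (hmem i hi x hx).1.1
    · exact fun i hi x hx => (hmem i hi x hx).1.2
    · exact fun i hi => (hf i hi).2
    · intro i hi j hj x hx hx'
      rw [← (hmem i hi x hx).2, ← (hmem j hj x hx').2]
  · exact fun i hi => ⟨f i, Finset.mem_image_of_mem _ (by simpa using hi), (hf i hi).1⟩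

theorem exists_extendsTo_colourSpread_lt_of_mem {k n : ℕ} (B : StarFamily) (hn : 2 ≤ n)
    (A : Finset (Fin n → Fin k)) :
    ∃ m C, ExtendsTo n B m C ∧ ∀ d : ℕ → Fin k, IsProper C d → (fun v : Fin n => d v) ∈ A →
      colourSpread d n < colourSpread d m := by
  induction A using Finset.induction_on with
  | empty => exact ⟨n, B, .refl, by simp⟩
  | insert f A _ ih =>
    obtain ⟨m, C, h, hA⟩ := ih
    by_cases hg : ∃ g : ℕ → Fin k, (fun v : Fin n => g v) = f
    · obtain ⟨g, rfl⟩ := hg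
      obtain ⟨F, hF, hgF⟩ := exists_monochromatic_triples g n
      refine ⟨_, _, h.step (hF.mono h.le), fun d hd hdA => ?_⟩
      rcases Finset.mem_insert.1 hdA with hdg | hdA
      · have hdg : ∀ v < n, d v = g v := fun v hv => congrFun hdg ⟨v, hv⟩
        have hcls : ∀ i, colourClass d n i = colourClass g n i := fun i =>
          Finset.filter_congr fun v hv => by rw [hdg v (Finset.mem_Ico.1 hv).2]
        refine colourSpread_lt d hn h.le (Nat.lt_add_of_pos_right (by norm_num)) ?_
        by_contra! hlt
        rw [hcls] at hlt
        obtain ⟨T, hT, hTc⟩ := hgF _ hlt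
        obtain ⟨a, ha, hne⟩ := hd (m, T) (mem_extendStars.2 (Or.inr (Or.inl ⟨Or.inl rfl, hT⟩)))
        have ha := hTc ha
        rw [← hcls] at ha
        exact hne (Finset.mem_filter.1 ha).2
      · exact (hA d (hd.mono (subset_extendStars _ _ _)) hdA).trans_le
          (colourSpread_mono d (Nat.le_add_right _ _))
    · refine ⟨m, C, h, fun d hd hdA => ?_⟩
      rcases Finset.mem_insert.1 hdA with hdf | hdA
      · exact absurd ⟨d, hdf⟩ hg
      · exact hA d hd hdA

theorem exists_extendsTo_le_colourSpread (k : ℕ) {n : ℕ} (B : StarFamily) (hn : 2 ≤ n) (j : ℕ) :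
    ∃ m C, ExtendsTo n B m C ∧ ∀ d : ℕ → Fin k, IsProper C d → j ≤ colourSpread d m := by
  induction j with
  | zero => exact ⟨n, B, .refl, fun _ _ => Nat.zero_le _⟩
  | succ j ih =>
    obtain ⟨m, C, h, hj⟩ := ih
    obtain ⟨l, D, h', hlt⟩ :=
      exists_extendsTo_colourSpread_lt_of_mem (k := k) C (hn.trans h.le) Finset.univ
    exact ⟨l, D, h.trans h', fun d hd =>
      (hj d (hd.mono h'.subset)).trans_lt (hlt d hd (Finset.mem_univ _))⟩

/-- Extensions can have arbitrarily large chromatic number. -/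
theorem exists_extendsTo_not_colourable (k : ℕ) {n : ℕ} (B : StarFamily) (hn : 2 ≤ n) :
    ∃ m C, ExtendsTo n B m C ∧ ¬ ∃ c : ℕ → Fin k, IsProper C c := by
  obtain ⟨m, C, h, hC⟩ := exists_extendsTo_le_colourSpread k B hn (k * 3 + 1)
  exact ⟨m, C, h, fun ⟨c, hc⟩ => by have := hC c hc; have := colourSpread_le c m; omega⟩

theorem exists_extendsTo_of_le {k n : ℕ} (hk : 2 ≤ k) {B : StarFamily}
    (hB : IsThreeStarSystem n B) (hn : 2 ≤ n) (hcol : ∃ c : ℕ → Fin k, IsProper B c) (t : ℕ) :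
    ∃ C, ExtendsTo n B (n + 3 * t) C ∧ ∃ c : ℕ → Fin k, IsProper C c := by
  induction t with
  | zero => exact ⟨B, .refl, hcol⟩
  | succ t ih =>
    obtain ⟨C, h, c, hc⟩ := ih
    exact ⟨_, h.step (isTripleFamily_empty _),
      hc.exists_extendStars_empty hk (h.isThreeStarSystem hB hn) (by omega)⟩

/-! ### Systems of orders six and seven -/

/-- A 3-star system of order six. -/
def starsSix : StarFamily :=
  {(0, {1, 2, 5}), (1, {2, 3, 5}), (2, {3, 4, 5}), (3, {4, 0, 5}), (4, {0, 1, 5})}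

/-- The cyclic 3-star system of order seven. -/
def starsSeven : StarFamily :=
  (Finset.range 7).image fun i => (i, {(i + 1) % 7, (i + 2) % 7, (i + 3) % 7})

instance (s : ℕ × Finset ℕ) (x y : ℕ) : Decidable (StarCovers s x y) :=
  inferInstanceAs (Decidable (_ ∨ _))

theorem isThreeStarSystem_starsSix : IsThreeStarSystem 6 starsSix := by
  constructor <;> decide

theorem isThreeStarSystem_starsSeven : IsThreeStarSystem 7 starsSeven := by
  constructor <;> decide

theorem exists_isProper_of_parity {k : ℕ} (hk : 2 ≤ k) {B : StarFamily}
    (hB : ∀ s ∈ B, ∃ a ∈ s.2, a % 2 ≠ s.1 % 2) : ∃ c : ℕ → Fin k, IsProper B c := by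
  refine ⟨fun v => ⟨v % 2, by omega⟩, fun s hs => ?_⟩
  simpa using hB s hs

theorem exists_base {k n : ℕ} (hk : 2 ≤ k) (hn : n % 3 = 0 ∨ n % 3 = 1) :
    ∃ m B, m % 3 = n % 3 ∧ 2 ≤ m ∧ IsThreeStarSystem m B ∧ ∃ c : ℕ → Fin k, IsProper B c := by
  rcases hn with h | h
  · exact ⟨6, starsSix, by omega, by norm_num, isThreeStarSystem_starsSix,
      exists_isProper_of_parity hk (by decide)⟩
  · exact ⟨7, starsSeven, by omega, by norm_num, isThreeStarSystem_starsSeven,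
      exists_isProper_of_parity hk (by decide)⟩

/-! ### Systems on `Fin n` -/

/-- The star on `Fin n` given by a star of a 3-star system on `{0, …, n - 1}`. -/
def IsThreeStarSystem.toEStar {n : ℕ} {B : StarFamily} (hB : IsThreeStarSystem n B)
    (s : {s // s ∈ B}) : EStar n 3 where
  centre := ⟨s.1.1, hB.centre_lt _ s.2⟩
  leaves := s.1.2.attachFin (hB.leaves_lt _ s.2)
  card_leaves := by rw [Finset.card_attachFin, hB.card_leaves _ s.2]
  centre_not_leaf := by simpa using hB.centre_not_leaf _ s.2

theorem IsThreeStarSystem.mem_edges_toEStar {n : ℕ} {B : StarFamily} (hB : IsThreeStarSystem n B)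
    (s : {s // s ∈ B}) (x y : Fin n) : s(x, y) ∈ (hB.toEStar s).edges ↔ StarCovers s.1 x y := by
  simp only [EStar.edges, toEStar, Finset.mem_image, Finset.mem_attachFin, Sym2.eq_iff, StarCovers,
    Fin.ext_iff]
  constructor
  · rintro ⟨a, ha, ⟨h, h'⟩ | ⟨h, h'⟩⟩
    · exact Or.inl ⟨h, h' ▸ ha⟩
    · exact Or.inr ⟨h, h' ▸ ha⟩
  · rintro (⟨h, h'⟩ | ⟨h, h'⟩)
    · exact ⟨y, h', Or.inl ⟨h, rfl⟩⟩
    · exact ⟨x, h', Or.inr ⟨h, rfl⟩⟩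

theorem StarCovers.symm {s : ℕ × Finset ℕ} {x y : ℕ} (h : StarCovers s x y) : StarCovers s y x :=
  Or.symm h

theorem IsThreeStarSystem.existsUnique_cover {n : ℕ} {B : StarFamily} (hB : IsThreeStarSystem n B)
    {x y : ℕ} (hx : x < n) (hy : y < n) (hxy : x ≠ y) : ∃! s, s ∈ B ∧ StarCovers s x y := by
  rcases lt_or_gt_of_ne hxy with h | h
  · obtain ⟨s, hs, hc⟩ := hB.exists_cover y hy x h
    exact ⟨s, ⟨hs, hc⟩, fun t ht => hB.cover_unique y hy x h t ht.1 s hs ht.2 hc⟩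
  · obtain ⟨s, hs, hc⟩ := hB.exists_cover x hx y h
    exact ⟨s, ⟨hs, hc.symm⟩, fun t ht => hB.cover_unique x hx y h t ht.1 s hs ht.2.symm hc⟩

/-- The 3-star system on `Fin n` given by one on `{0, …, n - 1}`. -/
def IsThreeStarSystem.toEStarSystem {n : ℕ} {B : StarFamily} (hB : IsThreeStarSystem n B) :
    EStarSystem n 3 where
  stars := B.attach.image hB.toEStar
  partition := by
    refine Sym2.ind fun x y hxy => ?_
    have hxy : (x : ℕ) ≠ y := fun h => hxy (Sym2.mk_isDiag_iff.2 (Fin.ext h))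
    obtain ⟨s, ⟨hs, hc⟩, hu⟩ := hB.existsUnique_cover x.2 y.2 hxy
    refine ⟨hB.toEStar ⟨s, hs⟩, ⟨Finset.mem_image_of_mem _ (Finset.mem_attach _ _),
      (hB.mem_edges_toEStar _ _ _).2 hc⟩, ?_⟩
    rintro S ⟨hS, hSc⟩
    obtain ⟨t, -, rfl⟩ := Finset.mem_image.1 hS
    rw [hB.mem_edges_toEStar] at hSc
    exact congrArg _ (Subtype.ext (hu t ⟨t.2, hSc⟩))

theorem IsThreeStarSystem.isWeakColouring_toEStarSystem {n k : ℕ} {B : StarFamily}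
    (hB : IsThreeStarSystem n B) (c : ℕ → Fin k) :
    IsWeakColouring hB.toEStarSystem (fun v => c v) ↔ IsProper B c := by
  simp only [IsWeakColouring, IsProper, toEStarSystem, Finset.forall_mem_image, Finset.mem_attach,
    forall_true_left, Subtype.forall, toEStar, Finset.mem_attachFin]
  refine forall₂_congr fun s hs => ?_
  exact ⟨fun ⟨a, ha, h⟩ => ⟨a, ha, h⟩, fun ⟨a, ha, h⟩ => ⟨⟨a, hB.leaves_lt s hs a ha⟩, ha, h⟩⟩

theorem IsThreeStarSystem.colourable_toEStarSystem {n k : ℕ} (hk : 0 < k) {B : StarFamily}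
    (hB : IsThreeStarSystem n B) :
    Colourable hB.toEStarSystem k ↔ ∃ c : ℕ → Fin k, IsProper B c := by
  constructor
  · rintro ⟨c, hc⟩
    let d : ℕ → Fin k := fun v => if h : v < n then c ⟨v, h⟩ else ⟨0, hk⟩
    have hd : (fun v : Fin n => d v) = c := by
      funext v
      simp [d]
    exact ⟨d, (hB.isWeakColouring_toEStarSystem d).1 (hd ▸ hc)⟩
  · rintro ⟨c, hc⟩
    exact ⟨_, (hB.isWeakColouring_toEStarSystem c).2 hc⟩

theorem exists_chromatic_of_mod_three {k r : ℕ} (hk : 2 ≤ k) (hr : r % 3 = 0 ∨ r % 3 = 1) :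
    ∃ m, ∀ n, m ≤ n → n % 3 = r % 3 → ∃ sys : EStarSystem n 3, Chromatic sys k := by
  obtain ⟨j, rfl⟩ : ∃ j, k = j + 1 := ⟨k - 1, by omega⟩
  obtain ⟨b, B, hb, hb2, hB, hcol⟩ := exists_base hk hr
  obtain ⟨_, _, hext, hnot⟩ := exists_extendsTo_not_colourable j B hb2
  obtain ⟨m, C, hC, hcolC, hnotC⟩ := hext.exists_chromatic hB hb2 hcol hnot
  have hm2 : 2 ≤ m := hb2.trans hC.le
  have hCsys := hC.isThreeStarSystem hB hb2
  refine ⟨m, fun n hmn hn => ?_⟩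
  have hmod := hC.mod_three
  obtain ⟨t, rfl⟩ : ∃ t, n = m + 3 * t := ⟨(n - m) / 3, by omega⟩
  obtain ⟨D, hD, hcolD⟩ := exists_extendsTo_of_le hk hCsys hm2 hcolC t
  have hDsys := hD.isThreeStarSystem hCsys hm2
  refine ⟨hDsys.toEStarSystem, (hDsys.colourable_toEStarSystem (by omega)).2 hcolD, fun h => ?_⟩
  obtain ⟨c, hc⟩ := (hDsys.colourable_toEStarSystem (k := j) (by omega)).1 h
  exact hnotC ⟨c, hc.mono hD.subset⟩

/-- For every `k ≥ 2` there is an `n_k` such that `k`-chromatic 3-star systems exist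
for all admissible orders `n ≥ n_k`. -/
theorem stmt8 (k : ℕ) (hk : 2 ≤ k) :
    ∃ nk : ℕ, ∀ n : ℕ, nk ≤ n → (n % 3 = 0 ∨ n % 3 = 1) →
      ∃ sys : EStarSystem n 3, Chromatic sys k := by
  obtain ⟨a, ha⟩ := exists_chromatic_of_mod_three (r := 0) hk (by omega)
  obtain ⟨b, hb⟩ := exists_chromatic_of_mod_three (r := 1) hk (by omega)
  refine ⟨max a b, fun n hn hmod => ?_⟩
  rcases hmod with h | h
  · exact ha n (by omega) h
  · exact hb n (by omega) h
end

section
/- For every integer e >= 3, there exists an e-star system of order 2e that is 2-chromatic and admits a strongly equitable 2-colouring (both colour classes of size e). -/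
/-- The arcs leaving a vertex `i < 2 * e - 1` in the tournament formed by the rotational
tournament on `{0, …, 2 * e - 2}` together with the sink `2 * e - 1`. -/
def RotArc (e i v : ℕ) : Prop :=
  (i < v ∧ v < i + e) ∨ v + e ≤ i ∨ v = 2 * e - 1

instance (e i v : ℕ) : Decidable (RotArc e i v) := by
  unfold RotArc; infer_instance

theorem card_filter_fin_eq_card {n : ℕ} (P : ℕ → Prop) [DecidablePred P] (s : Finset ℕ)
    (hs : ∀ v, v ∈ s ↔ v < n ∧ P v) :
    (Finset.univ.filter (fun v : Fin n => P v)).card = s.card := by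
  rw [← Finset.card_map Fin.valEmbedding]
  congr 1
  ext v
  simp only [Finset.mem_map, Finset.mem_filter, Finset.mem_univ, true_and,
    Fin.valEmbedding_apply, hs]
  constructor
  · rintro ⟨a, ha, rfl⟩
    exact ⟨a.2, ha⟩
  · rintro ⟨hv, hP⟩
    exact ⟨⟨v, hv⟩, hP, rfl⟩

theorem card_rotArc {e i : ℕ} (hi : i < 2 * e - 1) :
    (Finset.univ.filter (fun v : Fin (2 * e) => RotArc e i v)).card = e := by
  rcases lt_or_ge i e with h | h
  · rw [card_filter_fin_eq_card (RotArc e i) (insert (2 * e - 1) (Finset.Ioo i (i + e)))]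
    · rw [Finset.card_insert_of_notMem (by simp; omega), Nat.card_Ioo]
      omega
    · intro v
      simp only [Finset.mem_insert, Finset.mem_Ioo, RotArc]
      omega
  · rw [card_filter_fin_eq_card (RotArc e i)
      (Finset.range (i - e + 1) ∪ Finset.Ico (i + 1) (2 * e))]
    · rw [Finset.card_union_of_disjoint, Finset.card_range, Nat.card_Ico]
      · omega
      · rw [Finset.disjoint_left]
        intro v
        simp only [Finset.mem_range, Finset.mem_Ico]
        omega
    · intro v
      simp only [Finset.mem_union, Finset.mem_range, Finset.mem_Ico, RotArc]
      omega

/-- The out-star of a non-sink vertex. -/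
def rotStar (e : ℕ) (i : Fin (2 * e - 1)) : EStar (2 * e) e where
  centre := ⟨i, by omega⟩
  leaves := Finset.univ.filter (fun v : Fin (2 * e) => RotArc e i v)
  card_leaves := card_rotArc i.2
  centre_not_leaf := by
    intro h
    have harc : RotArc e i i := (Finset.mem_filter.1 h).2
    unfold RotArc at harc
    omega

theorem mk_mem_edges_rotStar {e : ℕ} (i : Fin (2 * e - 1)) (x y : Fin (2 * e)) :
    s(x, y) ∈ (rotStar e i).edges ↔
      (x.val = i ∧ RotArc e i y) ∨ (y.val = i ∧ RotArc e i x) := by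
  simp only [EStar.edges, rotStar, Finset.mem_image, Finset.mem_filter, Finset.mem_univ,
    true_and, Sym2.eq_iff, Fin.ext_iff]
  constructor
  · rintro ⟨a, ha, ⟨h₁, h₂⟩ | ⟨h₁, h₂⟩⟩
    · exact Or.inl ⟨h₁.symm, h₂ ▸ ha⟩
    · exact Or.inr ⟨h₁.symm, h₂ ▸ ha⟩
  · rintro (⟨h₁, h₂⟩ | ⟨h₁, h₂⟩)
    · exact ⟨y, h₂, Or.inl ⟨h₁.symm, rfl⟩⟩
    · exact ⟨x, h₂, Or.inr ⟨h₁.symm, rfl⟩⟩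

/-- The `e`-star system of order `2 * e` whose stars are the out-stars of the rotational
tournament with an added sink. -/
def rotSystem (e : ℕ) : EStarSystem (2 * e) e where
  stars := Finset.univ.image (rotStar e)
  partition := by
    intro p
    induction p using Sym2.ind with
    | _ x y =>
      intro hp
      have hxy : x.val ≠ y.val := fun h => hp (Sym2.mk_isDiag_iff.2 (Fin.ext h))
      have hx := x.2
      have hy := y.2
      have key : ∃ i : Fin (2 * e - 1), s(x, y) ∈ (rotStar e i).edges := by
        simp only [mk_mem_edges_rotStar]
        by_cases h : x.val < 2 * e - 1 ∧ RotArc e x y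
        · exact ⟨⟨x, h.1⟩, Or.inl ⟨rfl, h.2⟩⟩
        · unfold RotArc at h
          refine ⟨⟨y, by omega⟩, Or.inr ⟨rfl, ?_⟩⟩
          simp only [RotArc]
          omega
      obtain ⟨i, hi⟩ := key
      refine ⟨rotStar e i, ⟨Finset.mem_image_of_mem _ (Finset.mem_univ i), hi⟩, ?_⟩
      rintro S ⟨hS, hj⟩
      obtain ⟨j, -, rfl⟩ := Finset.mem_image.1 hS
      congr 1
      rw [mk_mem_edges_rotStar] at hi hj
      unfold RotArc at hi hj
      ext
      omega

/-- A colouring whose classes have at most `e` vertices is weak for every `e`-star system. -/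
theorem isWeakColouring_of_classCard_le {n e k : ℕ} (sys : EStarSystem n e)
    (c : Fin n → Fin k) (hc : ∀ i, classCard c i ≤ e) : IsWeakColouring sys c := by
  intro S _
  by_contra! h
  have hsub : insert S.centre S.leaves ⊆
      Finset.univ.filter (fun v => c v = c S.centre) := by
    intro v hv
    rcases Finset.mem_insert.1 hv with rfl | hv
    · simp
    · simpa using h v hv
  have hcard := (Finset.card_le_card hsub).trans (hc (c S.centre))
  rw [Finset.card_insert_of_notMem S.centre_not_leaf, S.card_leaves] at hcard
  omega

theorem exists_balanced_colouring (e : ℕ) :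
    ∃ c : Fin (2 * e) → Fin 2, ∀ i, classCard c i = e := by
  refine ⟨fun v => if v.val < e then 0 else 1, fun i => ?_⟩
  unfold classCard
  fin_cases i
  · refine (card_filter_fin_eq_card (fun v => (if v < e then (0 : Fin 2) else 1) = 0)
      (Finset.range e) fun v => ?_).trans (Finset.card_range e)
    by_cases h : v < e <;> simp [h]
    omega
  · refine (card_filter_fin_eq_card (fun v => (if v < e then (0 : Fin 2) else 1) = 1)
      (Finset.Ico e (2 * e)) fun v => ?_).trans (by rw [Nat.card_Ico]; omega)
    by_cases h : v < e <;> simp [h]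
    omega

theorem not_colourable_one_of_mem {n e : ℕ} {sys : EStarSystem n e} {S : EStar n e}
    (hS : S ∈ sys.stars) : ¬ Colourable sys 1 := by
  rintro ⟨c, hc⟩
  obtain ⟨a, -, ha⟩ := hc S hS
  exact ha (Subsingleton.elim _ _)

/-- For every `e ≥ 3` there is a strongly equitable 2-chromatic `e`-star system of
order `2e` (both colour classes of size `e`). -/
theorem stmt9 (e : ℕ) (he : 3 ≤ e) :
    ∃ sys : EStarSystem (2 * e) e, Chromatic sys 2 ∧
      ∃ c : Fin (2 * e) → Fin 2, IsWeakColouring sys c ∧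
        ∀ i : Fin 2, classCard c i = e := by
  obtain ⟨c, hc⟩ := exists_balanced_colouring e
  have hweak := isWeakColouring_of_classCard_le (rotSystem e) c fun i => (hc i).le
  have hmem : rotStar e ⟨0, by omega⟩ ∈ (rotSystem e).stars :=
    Finset.mem_image_of_mem _ (Finset.mem_univ _)
  exact ⟨rotSystem e, ⟨⟨c, hweak⟩, not_colourable_one_of_mem hmem⟩, c, hweak, hc⟩
end

section
/- Let k >= 3 and e >= 3. If there exists a strongly equitable k-chromatic e-star system of order n_0 ≡ 0 (mod 2e), then there exists some n ≡ 0 (mod 2e) and a strongly equitable uniquely k-chromatic e-star system of order n. -/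
/-- A coloured `e`-star system on an arbitrary finite vertex type, with `star v` the family of leaf
sets of the stars centred at `v`, together with an equitable weak `k`-colouring. -/
structure ColouredSystem (e k : ℕ) where
  V : Type
  [fintypeV : Fintype V]
  star : V → Set (Finset V)
  card_star : ∀ {v L}, L ∈ star v → L.card = e
  centre_notMem : ∀ {v L}, L ∈ star v → v ∉ L
  cover : ∀ {x y}, x ≠ y → (∃ L ∈ star x, y ∈ L) ∨ (∃ L ∈ star y, x ∈ L)
  star_unique : ∀ {x y L L'}, L ∈ star x → L' ∈ star x → y ∈ L → y ∈ L' → L = L'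
  star_asymm : ∀ {x y L L'}, L ∈ star x → y ∈ L → L' ∈ star y → x ∉ L'
  col : V → Fin k
  col_weak : ∀ {v L}, L ∈ star v → ∃ a ∈ L, col a ≠ col v
  classSize : ℕ
  card_class : ∀ i, (Finset.univ.filter fun v => col v = i).card = classSize
  dvd_card : 2 * e ∣ Fintype.card V

attribute [instance] ColouredSystem.fintypeV

namespace ColouredSystem

variable {e k : ℕ}

/-- Weak colourings with an arbitrary type of colours. -/
def Weak {C : Type} (A : ColouredSystem e k) (f : A.V → C) : Prop :=
  ∀ ⦃v L⦄, L ∈ A.star v → ∃ a ∈ L, f a ≠ f v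

/-- `A` has no weak colouring with `k - 1` colours. -/
def NotFewer (A : ColouredSystem e k) : Prop :=
  ∀ f : A.V → Fin (k - 1), ¬ A.Weak f

/-- `ι` embeds `A` as a coloured subsystem of `A'`. -/
structure Extends (A A' : ColouredSystem e k) (ι : A.V → A'.V) : Prop where
  injective : Function.Injective ι
  col_comp : ∀ x, A'.col (ι x) = A.col x
  weak_comp : ∀ {C : Type} {f : A'.V → C}, A'.Weak f → A.Weak (f ∘ ι)

lemma Extends.trans {A B C : ColouredSystem e k} {i : A.V → B.V} {j : B.V → C.V}
    (hi : Extends A B i) (hj : Extends B C j) : Extends A C (j ∘ i) where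
  injective := hj.injective.comp hi.injective
  col_comp x := by simp [hj.col_comp, hi.col_comp]
  weak_comp hf := hi.weak_comp (hj.weak_comp hf)

lemma Extends.refl (A : ColouredSystem e k) : Extends A A id where
  injective := Function.injective_id
  col_comp _ := rfl
  weak_comp hf := hf

lemma Extends.notFewer {A A' : ColouredSystem e k} {ι : A.V → A'.V} (h : Extends A A' ι)
    (hA : A.NotFewer) : A'.NotFewer := fun _ hf => hA _ (h.weak_comp hf)

lemma Extends.classSize_le {A A' : ColouredSystem e k} {ι : A.V → A'.V} (h : Extends A A' ι)
    (hk : 0 < k) : A.classSize ≤ A'.classSize := by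
  rw [← A.card_class ⟨0, hk⟩, ← A'.card_class ⟨0, hk⟩]
  refine Finset.card_le_card_of_injOn ι ?_ h.injective.injOn
  intro x hx
  simpa [h.col_comp] using hx

lemma NotFewer.surjective {A : ColouredSystem e k} (hA : A.NotFewer) {f : A.V → Fin k}
    (hf : A.Weak f) : Function.Surjective f := by
  intro q
  by_contra! h
  obtain ⟨g⟩ : Nonempty ({x : Fin k // x ≠ q} ≃ Fin (k - 1)) :=
    ⟨Fintype.equivFinOfCardEq (by simp)⟩
  refine hA (fun v => g ⟨f v, h v⟩) fun v L hL => ?_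
  obtain ⟨a, ha, hav⟩ := hf hL
  exact ⟨a, ha, by simpa using hav⟩

lemma NotFewer.classSize_pos {A : ColouredSystem e k} (hA : A.NotFewer) (hk : 0 < k) :
    0 < A.classSize := by
  obtain ⟨v, hv⟩ := hA.surjective (f := A.col) (fun _ _ h => A.col_weak h) ⟨0, hk⟩
  rw [← A.card_class ⟨0, hk⟩, Finset.card_pos]
  exact ⟨v, by simpa using hv⟩

lemma card_eq (A : ColouredSystem e k) : Fintype.card A.V = k * A.classSize := by
  have := Finset.card_eq_sum_card_fiberwise (s := (Finset.univ : Finset A.V))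
    (t := (Finset.univ : Finset (Fin k))) (f := A.col) (by simp)
  simpa [A.card_class] using this

end ColouredSystem

open ColouredSystem

/-- Partition `Q ∪ R` into sets consisting of one element of `Q` and `d` elements of `R`. -/
lemma exists_partition_transversal {V : Type} [DecidableEq V] (d : ℕ) (q : ℕ) :
    ∀ Q R : Finset V, Q.card = q → R.card = d * q → Disjoint Q R →
    ∃ P : Finset (Finset V), P.card = q ∧
      (∀ L ∈ P, L.card = d + 1 ∧ L ⊆ Q ∪ R ∧ ∃ x ∈ L, x ∈ Q) ∧
      (∀ x ∈ Q ∪ R, ∃ L ∈ P, x ∈ L) ∧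
      (∀ x, ∀ L ∈ P, ∀ L' ∈ P, x ∈ L → x ∈ L' → L = L') := by
  induction q with
  | zero =>
    intro Q R hQ hR _
    simp only [mul_zero, Finset.card_eq_zero] at hQ hR
    subst hQ hR
    exact ⟨∅, by simp⟩
  | succ q ih =>
    intro Q R hQ hR hd
    obtain ⟨g, hg⟩ := Finset.card_pos.1 (by omega : 0 < Q.card)
    obtain ⟨T, hT, hTc⟩ := Finset.exists_subset_card_eq (s := R) (n := d) (by rw [hR]; nlinarith)
    have hgR : g ∉ R := Finset.disjoint_left.1 hd hg
    have hgT : g ∉ T := fun h => hgR (hT h)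
    obtain ⟨P, hPc, hP, hcov, huniq⟩ := ih (Q.erase g) (R \ T)
      (by rw [Finset.card_erase_of_mem hg]; omega)
      (by rw [Finset.card_sdiff_of_subset hT, hR, hTc, mul_add]; omega)
      (hd.mono (Finset.erase_subset _ _) Finset.sdiff_subset)
    have hdisj : ∀ L ∈ P, ∀ x ∈ L, x ∉ insert g T := by
      intro L hL x hx hx'
      have h1 := (hP L hL).2.1 hx
      rw [Finset.disjoint_left] at hd
      simp only [Finset.mem_union, Finset.mem_erase, Finset.mem_sdiff, Finset.mem_insert] at h1 hx'
      grind
    refine ⟨insert (insert g T) P, ?_, ?_, ?_, ?_⟩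
    · rw [Finset.card_insert_of_notMem, hPc]
      exact fun h => hdisj _ h g (by simp) (by simp)
    · intro L hL
      rcases Finset.mem_insert.1 hL with rfl | hL
      · refine ⟨by rw [Finset.card_insert_of_notMem hgT, hTc], ?_, g, by simp, hg⟩
        grind
      · obtain ⟨h1, h2, x, hx, hxQ⟩ := hP L hL
        refine ⟨h1, ?_, x, hx, Finset.mem_of_mem_erase hxQ⟩
        grind
    · intro x hx
      by_cases hxT : x ∈ insert g T
      · exact ⟨_, by simp, hxT⟩
      · obtain ⟨L, hL, hxL⟩ := hcov x (by grind)
        exact ⟨L, by simp [hL], hxL⟩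
    · intro x L hL L' hL' hx hx'
      rcases Finset.mem_insert.1 hL with rfl | hL <;> rcases Finset.mem_insert.1 hL' with rfl | hL'
      · rfl
      · exact absurd hx (hdisj _ hL' x hx')
      · exact absurd hx' (hdisj _ hL x hx)
      · exact huniq x L hL L' hL' hx hx'

/-- A large enough set contains many disjoint subsets of a given size. -/
lemma exists_disjoint_family {V : Type} [DecidableEq V] {e t : ℕ} (he : 0 < e) (S : Finset V)
    (hS : t * e ≤ S.card) :
    ∃ P : Finset (Finset V), P.card = t ∧ (∀ L ∈ P, L.card = e ∧ L ⊆ S) ∧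
      (∀ x, ∀ L ∈ P, ∀ L' ∈ P, x ∈ L → x ∈ L' → L = L') := by
  obtain ⟨d, rfl⟩ : ∃ d, e = d + 1 := ⟨e - 1, by omega⟩
  obtain ⟨Q, hQ, hQc⟩ := Finset.exists_subset_card_eq (s := S) (n := t) (by nlinarith)
  obtain ⟨R, hR, hRc⟩ := Finset.exists_subset_card_eq (s := S \ Q) (n := d * t)
    (by rw [Finset.card_sdiff_of_subset hQ, hQc]; apply Nat.le_sub_of_add_le; nlinarith)
  obtain ⟨P, h1, h2, -, h4⟩ := exists_partition_transversal d t Q R hQc hRc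
    (Finset.disjoint_of_subset_right hR Finset.disjoint_sdiff)
  refine ⟨P, h1, fun L hL => ⟨(h2 L hL).1, (h2 L hL).2.1.trans ?_⟩, h4⟩
  exact Finset.union_subset hQ (hR.trans Finset.sdiff_subset)

namespace ColouredSystem

variable {e k : ℕ}

/-- A family of leaf sets in `A` that may be prescribed for the stars centred at a new vertex of
colour `i`. -/
structure Prescribable (A : ColouredSystem e k) (i : Fin k) (F : Finset (Finset A.V)) : Prop where
  card_eq : ∀ L ∈ F, L.card = e
  not_mono : ∀ L ∈ F, ∃ x ∈ L, A.col x ≠ i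
  unique : ∀ x, ∀ L ∈ F, ∀ L' ∈ F, x ∈ L → x ∈ L' → L = L'
  card_mul_le : F.card * e ≤ A.classSize

/-- A prescribable family extends to a partition of the vertex set into leaf sets. -/
lemma Prescribable.exists_partition (hk : 3 ≤ k) (he : 3 ≤ e) {A : ColouredSystem e k} {i : Fin k}
    {F : Finset (Finset A.V)} (hF : A.Prescribable i F) :
    ∃ P : Finset (Finset A.V), F ⊆ P ∧ (∀ L ∈ P, L.card = e ∧ ∃ x ∈ L, A.col x ≠ i) ∧
      (∀ x, ∃ L ∈ P, x ∈ L) ∧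
      (∀ x, ∀ L ∈ P, ∀ L' ∈ P, x ∈ L → x ∈ L' → L = L') := by
  classical
  obtain ⟨N, hN⟩ := (Dvd.intro_left 2 rfl : e ∣ 2 * e).trans A.dvd_card
  set U := F.biUnion id with hU
  have hUc : U.card = F.card * e := by
    rw [hU, Finset.card_biUnion]
    · exact Finset.sum_const_nat hF.card_eq
    · intro L hL L' hL' hne
      refine Finset.disjoint_left.2 fun x hx hx' => hne (hF.unique x L hL L' hL' hx hx')
  have hcard := A.card_eq
  have hG : k * A.classSize ≤
      (Finset.univ.filter fun v => A.col v ≠ i).card + A.classSize := by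
    rw [← hcard, ← A.card_class i, add_comm, Finset.card_filter_add_card_filter_not]
    simp
  have hG' : (Finset.univ.filter fun v => A.col v ≠ i).card ≤
      ((Finset.univ.filter fun v => A.col v ≠ i) \ U).card + U.card := by
    have := Finset.le_card_sdiff U (Finset.univ.filter fun v => A.col v ≠ i)
    omega
  have hle := hF.card_mul_le
  have hrN : F.card ≤ N := by
    have : F.card * e ≤ N * e := by nlinarith
    exact Nat.le_of_mul_le_mul_right this (by omega)
  obtain ⟨q, rfl⟩ := Nat.exists_eq_add_of_le hrN
  have hq : q ≤ ((Finset.univ.filter fun v => A.col v ≠ i) \ U).card := by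
    have h3 : 3 * (F.card + q) ≤ k * A.classSize := by nlinarith
    have h4 : 3 * A.classSize ≤ k * A.classSize := by nlinarith
    rw [hUc] at hG'
    omega
  obtain ⟨Q, hQ, hQc⟩ := Finset.exists_subset_card_eq hq
  obtain ⟨d, rfl⟩ : ∃ d, e = d + 1 := ⟨e - 1, by omega⟩
  have hQU : ∀ x ∈ Q, A.col x ≠ i ∧ x ∉ U := by
    intro x hx
    simpa using hQ hx
  have hdisj : Disjoint U Q := Finset.disjoint_right.2 fun x hx => (hQU x hx).2
  obtain ⟨P, -, hP, hcov, huniq⟩ := exists_partition_transversal d q Q (U ∪ Q)ᶜ hQc (by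
      rw [Finset.card_compl, Finset.card_union_of_disjoint hdisj, hUc, hQc, hN]
      apply Nat.sub_eq_of_eq_add
      ring) (Finset.disjoint_right.2 fun x hx hx' => by simp [hx'] at hx)
  have hPU : ∀ L ∈ P, ∀ x ∈ L, x ∉ U := by
    intro L hL x hx hxU
    rcases Finset.mem_union.1 ((hP L hL).2.1 hx) with h | h
    · exact (hQU x h).2 hxU
    · simp [hxU] at h
  have hFU : ∀ L ∈ F, ∀ x ∈ L, x ∈ U := fun L hL x hx => Finset.mem_biUnion.2 ⟨L, hL, hx⟩
  refine ⟨F ∪ P, Finset.subset_union_left, ?_, ?_, ?_⟩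
  · intro L hL
    rcases Finset.mem_union.1 hL with hL | hL
    · exact ⟨hF.card_eq L hL, hF.not_mono L hL⟩
    · obtain ⟨h1, -, x, hx, hxQ⟩ := hP L hL
      exact ⟨h1, x, hx, (hQU x hxQ).1⟩
  · intro x
    by_cases hx : x ∈ U
    · obtain ⟨L, hL, hxL⟩ := Finset.mem_biUnion.1 hx
      exact ⟨L, Finset.mem_union_left _ hL, hxL⟩
    · obtain ⟨L, hL, hxL⟩ := hcov x (by simp [hx]; tauto)
      exact ⟨L, Finset.mem_union_right _ hL, hxL⟩
  · intro x L hL L' hL' hx hx'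
    rcases Finset.mem_union.1 hL with hL | hL <;> rcases Finset.mem_union.1 hL' with hL' | hL'
    · exact hF.unique x L hL L' hL' hx hx'
    · exact absurd (hFU L hL x hx) (hPU L' hL' x hx')
    · exact absurd (hFU L' hL' x hx') (hPU L hL x hx)
    · exact huniq x L hL L' hL' hx hx'

/-- The disjoint union of `A` and `B`, where `P u` partitions the vertices of `A` into the leaf sets
of the stars that join `u` to `A`. -/
def join (A B : ColouredSystem e k) (P : B.V → Finset (Finset A.V))
    (hP : ∀ u, ∀ L ∈ P u, L.card = e ∧ ∃ x ∈ L, A.col x ≠ B.col u)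
    (hcov : ∀ u x, ∃ L ∈ P u, x ∈ L)
    (huniq : ∀ u x, ∀ L ∈ P u, ∀ L' ∈ P u, x ∈ L → x ∈ L' → L = L') : ColouredSystem e k where
  V := A.V ⊕ B.V
  star := Sum.elim (fun v => {L | ∃ K ∈ A.star v, K.map .inl = L})
    (fun u => {L | (∃ K ∈ P u, K.map .inl = L) ∨ ∃ K ∈ B.star u, K.map .inr = L})
  card_star := by
    rintro (v | u) L hL
    · obtain ⟨K, hK, rfl⟩ := hL
      simpa using A.card_star hK
    · obtain ⟨K, hK, rfl⟩ | ⟨K, hK, rfl⟩ := hL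
      · simpa using (hP u K hK).1
      · simpa using B.card_star hK
  centre_notMem := by
    rintro (v | u) L hL
    · obtain ⟨K, hK, rfl⟩ := hL
      simpa using A.centre_notMem hK
    · obtain ⟨K, hK, rfl⟩ | ⟨K, hK, rfl⟩ := hL
      · simp
      · simpa using B.centre_notMem hK
  cover := by
    rintro (x | x) (y | y) hxy
    · rcases A.cover (fun h => hxy (congrArg _ h)) with ⟨L, hL, h⟩ | ⟨L, hL, h⟩
      · exact .inl ⟨_, ⟨L, hL, rfl⟩, by simpa using h⟩
      · exact .inr ⟨_, ⟨L, hL, rfl⟩, by simpa using h⟩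
    · obtain ⟨L, hL, h⟩ := hcov y x
      exact .inr ⟨_, .inl ⟨L, hL, rfl⟩, by simpa using h⟩
    · obtain ⟨L, hL, h⟩ := hcov x y
      exact .inl ⟨_, .inl ⟨L, hL, rfl⟩, by simpa using h⟩
    · rcases B.cover (fun h => hxy (congrArg _ h)) with ⟨L, hL, h⟩ | ⟨L, hL, h⟩
      · exact .inl ⟨_, .inr ⟨L, hL, rfl⟩, by simpa using h⟩
      · exact .inr ⟨_, .inr ⟨L, hL, rfl⟩, by simpa using h⟩
  star_unique := by
    rintro (x | x) y L L' hL hL' hy hy'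
    · obtain ⟨K, hK, rfl⟩ := hL
      obtain ⟨K', hK', rfl⟩ := hL'
      obtain ⟨z, hz, rfl⟩ := Finset.mem_map.1 hy
      rw [A.star_unique hK hK' hz (by simpa using hy')]
    · obtain ⟨K, hK, rfl⟩ | ⟨K, hK, rfl⟩ := hL <;>
      obtain ⟨K', hK', rfl⟩ | ⟨K', hK', rfl⟩ := hL' <;>
      obtain ⟨z, hz, rfl⟩ := Finset.mem_map.1 hy
      · rw [huniq x z K hK K' hK' hz (by simpa using hy')]
      · simp at hy'
      · simp at hy'
      · rw [B.star_unique hK hK' hz (by simpa using hy')]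
  star_asymm := by
    rintro (x | x) (y | y) L L' hL hy hL' hx
    · obtain ⟨K, hK, rfl⟩ := hL
      obtain ⟨K', hK', rfl⟩ := hL'
      exact A.star_asymm hK (by simpa using hy) hK' (by simpa using hx)
    · obtain ⟨K, hK, rfl⟩ := hL
      simp at hy
    · obtain ⟨K, hK, rfl⟩ := hL'
      simp at hx
    · obtain ⟨K, hK, rfl⟩ | ⟨K, hK, rfl⟩ := hL <;>
      obtain ⟨K', hK', rfl⟩ | ⟨K', hK', rfl⟩ := hL'
      · simp at hy
      · simp at hy
      · simp at hx
      · exact B.star_asymm hK (by simpa using hy) hK' (by simpa using hx)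
  col := Sum.elim A.col B.col
  col_weak := by
    rintro (v | u) L hL
    · obtain ⟨K, hK, rfl⟩ := hL
      simpa using A.col_weak hK
    · obtain ⟨K, hK, rfl⟩ | ⟨K, hK, rfl⟩ := hL
      · simpa using (hP u K hK).2
      · simpa using B.col_weak hK
  classSize := A.classSize + B.classSize
  card_class i := by
    rw [← A.card_class i, ← B.card_class i, ← Finset.card_disjSum]
    congr 1
    ext (v | v) <;> simp
  dvd_card := by
    rw [Fintype.card_sum]
    exact dvd_add A.dvd_card B.dvd_card

/-- In every weak colouring, the vertex `j u` is not coloured like all of a set `L ∈ F u`. -/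
def Avoids {A B A' : ColouredSystem e k} (ι : A.V → A'.V) (F : B.V → Finset (Finset A.V))
    (j : B.V → A'.V) : Prop :=
  ∀ {C : Type} {f : A'.V → C}, A'.Weak f → ∀ u, ∀ L ∈ F u, ∃ a ∈ L, f (ι a) ≠ f (j u)

lemma exists_extension (hk : 3 ≤ k) (he : 3 ≤ e) (A B : ColouredSystem e k)
    (F : B.V → Finset (Finset A.V)) (hF : ∀ u, A.Prescribable (B.col u) (F u)) :
    ∃ (A' : ColouredSystem e k) (ι : A.V → A'.V) (j : B.V → A'.V), Extends A A' ι ∧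
      Extends B A' j ∧ Avoids ι F j ∧ (∀ x, x ∈ Set.range ι ∨ x ∈ Set.range j) ∧
      A'.classSize = A.classSize + B.classSize := by
  choose P hFP hP hcov huniq using fun u => (hF u).exists_partition hk he
  refine ⟨A.join B P hP hcov huniq, Sum.inl, Sum.inr, ⟨Sum.inl_injective, fun _ => rfl, ?_⟩,
    ⟨Sum.inr_injective, fun _ => rfl, ?_⟩, ?_, ?_, rfl⟩
  · intro C f hf v L hL
    obtain ⟨a, ha, h⟩ := hf (v := Sum.inl v) (L := L.map .inl) ⟨L, hL, rfl⟩
    obtain ⟨b, hb, rfl⟩ := Finset.mem_map.1 ha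
    exact ⟨b, hb, h⟩
  · intro C f hf v L hL
    obtain ⟨a, ha, h⟩ := hf (v := Sum.inr v) (L := L.map .inr) (.inr ⟨L, hL, rfl⟩)
    obtain ⟨b, hb, rfl⟩ := Finset.mem_map.1 ha
    exact ⟨b, hb, h⟩
  · intro C f hf u L hL
    obtain ⟨a, ha, h⟩ := hf (v := Sum.inr u) (L := L.map .inl) (.inl ⟨L, hFP u hL, rfl⟩)
    obtain ⟨b, hb, rfl⟩ := Finset.mem_map.1 ha
    exact ⟨b, hb, h⟩
  · rintro (x | x)
    · exact .inl ⟨x, rfl⟩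
    · exact .inr ⟨x, rfl⟩

/-- Simultaneously add one copy of `B` for each of finitely many prescribed families. -/
lemma exists_extension_finset (hk : 3 ≤ k) (he : 3 ≤ e) (A B : ColouredSystem e k) {X : Type}
    (s : Finset X) (F : X → B.V → Finset (Finset A.V))
    (hF : ∀ x u, A.Prescribable (B.col u) (F x u)) :
    ∃ (A' : ColouredSystem e k) (ι : A.V → A'.V), Extends A A' ι ∧
      (∀ x ∈ s, ∃ j : B.V → A'.V, Extends B A' j ∧ Avoids ι (F x) j) ∧
      (∀ y, y ∈ Set.range ι ∨ ∃ x ∈ s, ∃ j : B.V → A'.V, Extends B A' j ∧ Avoids ι (F x) j ∧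
        y ∈ Set.range j) := by
  classical
  induction s using Finset.induction_on with
  | empty => exact ⟨A, id, .refl A, by simp, by simp⟩
  | insert x s hx ih =>
    obtain ⟨A₁, ι, hι, hs, hc⟩ := ih
    obtain ⟨A₂, i, j, hi, hj, hav, hrange, -⟩ := exists_extension hk he A₁ B
      (fun u => (F x u).image (Finset.image ι)) (fun u => by
        refine ⟨?_, ?_, ?_, ?_⟩
        · simp only [Finset.forall_mem_image]
          intro L hL
          rw [Finset.card_image_of_injective _ hι.injective, (hF x u).card_eq L hL]
        · simp only [Finset.forall_mem_image]
          intro L hL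
          obtain ⟨a, ha, h⟩ := (hF x u).not_mono L hL
          exact ⟨ι a, Finset.mem_image_of_mem _ ha, by rwa [hι.col_comp]⟩
        · simp only [Finset.forall_mem_image]
          intro y L hL L' hL' hy hy'
          obtain ⟨a, ha, rfl⟩ := Finset.mem_image.1 hy
          rw [(hF x u).unique a L hL L' hL' ha
            (hι.injective.mem_finset_image.1 hy')]
        · exact (Nat.mul_le_mul_right _ Finset.card_image_le).trans
            ((hF x u).card_mul_le.trans (hι.classSize_le (by omega))))
    have hold : ∀ y ∈ s, ∀ j' : B.V → A₁.V, Extends B A₁ j' ∧ Avoids ι (F y) j' →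
        Extends B A₂ (i ∘ j') ∧ Avoids (i ∘ ι) (F y) (i ∘ j') := fun y _ j' h =>
      ⟨h.1.trans hi, fun hf => h.2 (hi.weak_comp hf)⟩
    have hnew : Avoids (i ∘ ι) (F x) j := by
      intro C f hf u L hL
      obtain ⟨a, ha, h⟩ := hav hf u (L.image ι) (Finset.mem_image_of_mem _ hL)
      obtain ⟨b, hb, rfl⟩ := Finset.mem_image.1 ha
      exact ⟨b, hb, h⟩
    refine ⟨A₂, i ∘ ι, hι.trans hi, ?_, ?_⟩
    · intro y hy
      rcases Finset.mem_insert.1 hy with rfl | hy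
      · exact ⟨j, hj, hnew⟩
      · obtain ⟨j', h⟩ := hs y hy
        exact ⟨_, hold y hy j' h⟩
    · intro y
      rcases hrange y with ⟨z, rfl⟩ | h
      · rcases hc z with ⟨w, rfl⟩ | ⟨y, hy, j', h1, h2, w, rfl⟩
        · exact .inl ⟨w, rfl⟩
        · obtain ⟨h3, h4⟩ := hold y hy j' ⟨h1, h2⟩
          exact .inr ⟨y, by simp [hy], _, h3, h4, w, rfl⟩
      · exact .inr ⟨x, by simp, j, hj, hnew, h⟩

/-- Colour classes can be made arbitrarily large. -/
lemma exists_classSize_ge (hk : 3 ≤ k) (he : 3 ≤ e) {B : ColouredSystem e k} (hB : B.NotFewer)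
    (t : ℕ) : ∃ A : ColouredSystem e k, A.NotFewer ∧ t ≤ A.classSize := by
  induction t with
  | zero => exact ⟨B, hB, Nat.zero_le _⟩
  | succ t ih =>
    obtain ⟨A, hA, ht⟩ := ih
    obtain ⟨A', ι, -, hι, -, -, -, h⟩ := exists_extension hk he A B (fun _ => ∅)
      (fun u => ⟨by simp, by simp, by simp, by simp⟩)
    have := hB.classSize_pos (by omega)
    exact ⟨A', hι.notFewer hA, by omega⟩

/-- The leaf sets `Y i` of colours `i ≠ c` may be prescribed at a vertex of colour `c`. -/
lemma prescribable_image {A : ColouredSystem e k} (he : 0 < e) (hA : k * e ≤ A.classSize)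
    {Y : Fin k → Finset A.V} (hc : ∀ i, (Y i).card = e) (hY : ∀ i, ∀ x ∈ Y i, A.col x = i)
    [DecidableEq (Finset A.V)] (c : Fin k) :
    A.Prescribable c ((Finset.univ.filter (· ≠ c)).image Y) := by
  refine ⟨?_, ?_, ?_, ?_⟩
  · simp [hc]
  · simp only [Finset.forall_mem_image]
    intro i hi
    obtain ⟨x, hx⟩ := Finset.card_pos.1 ((hc i).symm ▸ he)
    exact ⟨x, hx, by simpa [hY i x hx] using hi⟩
  · simp only [Finset.forall_mem_image]
    intro x i _ i' _ hx hx'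
    rw [← hY i x hx, hY i' x hx']
  · refine (Nat.mul_le_mul_right e ?_).trans hA
    exact Finset.card_image_le.trans ((Finset.card_le_univ _).trans (by simp))

/-- In a suitable extension, every weak `k`-colouring agrees, up to permuting the colours, with the
given one on all but few vertices of some large set. -/
lemma exists_nearly_rigid (he : 3 ≤ e) (hk : 3 ≤ k) {B : ColouredSystem e k} (hB : B.NotFewer)
    (hBk : k * e ≤ B.classSize) :
    ∃ (A : ColouredSystem e k) (Y : Fin k → Finset A.V), A.NotFewer ∧
      B.classSize ≤ A.classSize ∧ (∀ i, (Y i).card = B.classSize) ∧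
      (∀ i, ∀ x ∈ Y i, A.col x = i) ∧
      ∀ f : A.V → Fin k, A.Weak f → ∃ p : Equiv.Perm (Fin k),
        ∀ i, ((Y i).filter fun x => f x ≠ p i).card < k * e := by
  classical
  let X := {Y : Fin k → Finset B.V // (∀ i, (Y i).card = e) ∧ ∀ i, ∀ x ∈ Y i, B.col x = i}
  obtain ⟨A, ι, hι, hblock, -⟩ := exists_extension_finset hk he B B (Finset.univ : Finset X)
    (fun Y u => (Finset.univ.filter (· ≠ B.col u)).image Y.1)
    (fun Y u => prescribable_image (by omega) hBk Y.2.1 Y.2.2 _)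
  refine ⟨A, fun i => (Finset.univ.filter fun x => B.col x = i).image ι, hι.notFewer hB,
    hι.classSize_le (by omega), ?_, ?_, ?_⟩
  · intro i
    rw [Finset.card_image_of_injective _ hι.injective, B.card_class]
  · intro i
    simp only [Finset.forall_mem_image]
    intro x hx
    simpa [hι.col_comp] using hx
  intro f hf
  let N : Fin k → Fin k → Finset B.V := fun i q =>
    Finset.univ.filter fun x => B.col x = i ∧ f (ι x) = q
  have hinj : ∀ p : Fin k → Fin k, (∀ i, e ≤ (N i (p i)).card) → Function.Injective p := by
    intro p hp
    choose Y hYs hYc using fun i => Finset.exists_subset_card_eq (hp i)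
    have hY : ∀ i, ∀ x ∈ Y i, B.col x = i ∧ f (ι x) = p i := fun i x hx => by
      simpa [N] using hYs i hx
    obtain ⟨j, hj, hav⟩ := hblock ⟨Y, hYc, fun i x hx => (hY i x hx).1⟩ (Finset.mem_univ _)
    intro i i' hii
    by_contra hne
    obtain ⟨u, hu⟩ := hB.surjective (hj.weak_comp hf) (p i)
    have key : ∀ l, l ≠ B.col u → p l ≠ p i := by
      intro l hl hpl
      obtain ⟨a, ha, h⟩ := hav hf u (Y l) (Finset.mem_image_of_mem _ (by simpa using hl))
      exact h (by rw [(hY l a ha).2, hpl]; exact hu.symm)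
    by_cases h : i = B.col u
    · exact key i' (fun h' => hne (h.trans h'.symm)) hii.symm
    · exact key i h rfl
  have hlarge : ∀ i, ∃ q, e ≤ (N i q).card := by
    intro i
    by_contra! h
    have h1 := Finset.card_eq_sum_card_fiberwise
      (s := Finset.univ.filter fun x => B.col x = i)
      (t := (Finset.univ : Finset (Fin k))) (f := fun x => f (ι x)) (by simp)
    simp only [Finset.filter_filter, B.card_class] at h1
    have h2 := Finset.sum_lt_sum_of_nonempty (s := (Finset.univ : Finset (Fin k)))
      ⟨⟨0, by omega⟩, Finset.mem_univ _⟩ (fun q _ => h q)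
    simp only [Finset.sum_const, Finset.card_univ, Fintype.card_fin, smul_eq_mul] at h2
    have h3 : ∑ q, (N i q).card = B.classSize := h1.symm
    omega
  choose p hp using hlarge
  have hpi := hinj p hp
  have hsmall : ∀ i q, q ≠ p i → (N i q).card < e := by
    intro i q hq
    by_contra! h
    have hup := hinj (Function.update p i q) (fun l => by
      by_cases hl : l = i
      · subst hl; simpa using h
      · simpa [hl] using hp l)
    obtain ⟨l, rfl⟩ := (Finite.injective_iff_surjective.1 hpi) q
    have hl : l ≠ i := fun h => hq (by rw [h])
    exact hl (hup (by simp [hl]))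
  refine ⟨Equiv.ofBijective p (Finite.injective_iff_bijective.1 hpi), fun i => ?_⟩
  have hsub : (((Finset.univ.filter fun x => B.col x = i).image ι).filter fun x => f x ≠ p i) ⊆
      ((Finset.univ.filter (· ≠ p i)).biUnion (N i)).image ι := by
    intro y hy
    simp only [Finset.mem_filter, Finset.mem_image, Finset.mem_univ, true_and] at hy
    obtain ⟨⟨x, hx, rfl⟩, h⟩ := hy
    exact Finset.mem_image_of_mem _ (Finset.mem_biUnion.2 ⟨f (ι x), by simpa using h,
      by simp [N, hx]⟩)
  calc _ ≤ _ := Finset.card_le_card hsub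
    _ ≤ _ := Finset.card_image_le
    _ ≤ (Finset.univ.filter (· ≠ p i)).card * (e - 1) :=
      Finset.card_biUnion_le_card_mul _ _ _ fun q hq => by
        have := hsmall i q (by simpa using hq)
        omega
    _ ≤ k * (e - 1) := Nat.mul_le_mul_right _ ((Finset.card_le_univ _).trans (by simp))
    _ < k * e := Nat.mul_lt_mul_of_pos_left (by omega) (by omega)

lemma eq_of_forall_ne {p : Equiv.Perm (Fin k)} {c q : Fin k} (h : ∀ i, i ≠ c → q ≠ p i) :
    q = p c := by
  by_contra hne
  refine h (p.symm q) (fun h' => hne ?_) (by simp)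
  rw [← h', Equiv.apply_symm_apply]

/-- In a suitable extension, every weak `k`-colouring agrees, up to permuting the colours, with the
given one on some fixed `e` vertices of each colour. -/
lemma exists_rigid_set (he : 3 ≤ e) (hk : 3 ≤ k) {B : ColouredSystem e k} (hB : B.NotFewer)
    (hBk : k * (k * e) * e ≤ B.classSize) :
    ∃ (A : ColouredSystem e k) (Y : Fin k → Finset A.V), A.NotFewer ∧
      B.classSize ≤ A.classSize ∧ (∀ i, (Y i).card = e) ∧
      (∀ i, ∀ x ∈ Y i, A.col x = i) ∧
      ∀ f : A.V → Fin k, A.Weak f → ∃ p : Equiv.Perm (Fin k), ∀ i, ∀ x ∈ Y i, f x = p i := by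
  classical
  have hke : k * e * e ≤ B.classSize := by
    refine le_trans ?_ hBk
    rw [mul_assoc k (k * e) e]
    exact Nat.le_mul_of_pos_left _ (by omega)
  have hke' : k * e ≤ B.classSize := le_trans (Nat.le_mul_of_pos_right _ (by omega)) hke
  obtain ⟨A, Y, hA, hsize, hYc, hY, hf⟩ := exists_nearly_rigid he hk hB hke'
  choose P hPc hP huniq using fun i =>
    exists_disjoint_family (e := e) (t := k * e) (by omega) (Y i) (by rw [hYc]; exact hke)
  have hPcol : ∀ i, ∀ L ∈ P i, ∀ x ∈ L, A.col x = i := fun i L hL x hx =>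
    hY i x ((hP i L hL).2 hx)
  obtain ⟨A', ι, j, hι, hj, hav, -, -⟩ := exists_extension hk he A B
    (fun u => (Finset.univ.filter (· ≠ B.col u)).biUnion P) (fun u => by
      simp only [ne_eq]
      refine ⟨?_, ?_, ?_, ?_⟩
      · intro L hL
        obtain ⟨i, -, hL⟩ := Finset.mem_biUnion.1 hL
        exact (hP i L hL).1
      · intro L hL
        obtain ⟨i, hi, hL⟩ := Finset.mem_biUnion.1 hL
        obtain ⟨x, hx⟩ := Finset.card_pos.1 (by rw [(hP i L hL).1]; omega : 0 < L.card)
        exact ⟨x, hx, by simpa [hPcol i L hL x hx] using hi⟩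
      · intro x L hL L' hL' hx hx'
        obtain ⟨i, -, hL⟩ := Finset.mem_biUnion.1 hL
        obtain ⟨i', -, hL'⟩ := Finset.mem_biUnion.1 hL'
        obtain rfl : i = i' := by rw [← hPcol i L hL x hx, hPcol i' L' hL' x hx']
        exact huniq i x L hL L' hL' hx hx'
      · refine (Nat.mul_le_mul_right e ?_).trans (hBk.trans hsize)
        refine (Finset.card_biUnion_le_card_mul _ _ (k * e) fun i _ => (hPc i).le).trans ?_
        exact Nat.mul_le_mul_right _ ((Finset.card_le_univ _).trans (by simp)))
  choose Z hZs hZc using fun i => Finset.exists_subset_card_eq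
    (s := Finset.univ.filter fun u => B.col u = i) (n := e)
    (by rw [B.card_class]; exact le_trans (Nat.le_mul_of_pos_left _ (by omega)) hke')
  have hZ : ∀ i, ∀ u ∈ Z i, B.col u = i := fun i u hu => by simpa using hZs i hu
  refine ⟨A', fun i => (Z i).image j, hj.notFewer hB, hj.classSize_le (by omega), ?_, ?_, ?_⟩
  · intro i
    rw [Finset.card_image_of_injective _ hj.injective, hZc]
  · intro i
    simp only [Finset.forall_mem_image]
    intro u hu
    rw [hj.col_comp, hZ i u hu]
  intro g hg
  obtain ⟨p, hp⟩ := hf _ (hι.weak_comp hg)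
  refine ⟨p, fun i => ?_⟩
  simp only [Finset.forall_mem_image]
  intro u hu
  apply eq_of_forall_ne
  intro l hl hul
  have hpure : ∃ L ∈ P l, ∀ x ∈ L, g (ι x) = p l := by
    by_contra! h
    choose b hbL hb using h
    have := Finset.card_le_card_of_injOn (s := (P l).attach)
      (t := (Y l).filter fun x => (g ∘ ι) x ≠ p l) (fun L => b L.1 L.2)
      (fun L _ => by
        simp only [Finset.coe_filter, Set.mem_ofPred_eq]
        exact ⟨(hP l _ L.2).2 (hbL _ L.2), hb _ L.2⟩)
      (fun L _ L' _ h => Subtype.ext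
        (huniq l _ _ L.2 _ L'.2 (hbL _ L.2) (by
          have h' : b L.1 L.2 = b L'.1 L'.2 := h
          rw [h']
          exact hbL _ L'.2)))
    rw [Finset.card_attach, hPc] at this
    exact absurd (hp l) (not_lt.2 this)
  obtain ⟨L, hL, hLp⟩ := hpure
  obtain ⟨a, ha, h⟩ := hav hg u L
    (Finset.mem_biUnion.2 ⟨l, by simpa [hZ i u hu] using hl, hL⟩)
  exact h (by rw [hLp a ha, hul])

/-- In a suitable extension, the given colouring is the only weak `k`-colouring. -/
lemma exists_rigid (he : 3 ≤ e) (hk : 3 ≤ k) {B : ColouredSystem e k} (hB : B.NotFewer)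
    (hBk : k * (k * e) * e ≤ B.classSize) :
    ∃ A : ColouredSystem e k, A.NotFewer ∧
      ∀ f : A.V → Fin k, A.Weak f → ∃ p : Equiv.Perm (Fin k), ∀ x, f x = p (A.col x) := by
  classical
  obtain ⟨A, Y, hA, hsize, hYc, hY, hf⟩ := exists_rigid_set he hk hB hBk
  have hke : (k + 1) * e ≤ A.classSize := by
    refine le_trans (Nat.mul_le_mul_right e ?_) (hBk.trans hsize)
    have : k * 3 ≤ k * (k * e) := Nat.mul_le_mul_left k (by nlinarith)
    omega
  have hYne : ∀ i, ∃ x, x ∈ Y i := fun i =>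
    Finset.card_pos.1 (by rw [hYc]; omega : 0 < (Y i).card)
  choose y hy using hYne
  let X := {s : A.V × Fin k // (∀ i, s.1 ∉ Y i) ∧ s.2 ≠ A.col s.1}
  let T : X → Finset A.V := fun s => insert s.1.1 ((Y s.1.2).erase (y s.1.2))
  have hT : ∀ s : X, ∀ i, i ≠ s.1.2 → ∀ x ∈ T s, x ∉ Y i := by
    intro s i hi x hx hxi
    rcases Finset.mem_insert.1 hx with rfl | hx
    · exact s.2.1 i hxi
    · exact hi (by rw [← hY i x hxi, hY _ x (Finset.mem_of_mem_erase hx)])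
  let G : B.V → Finset (Finset A.V) := fun u => (Finset.univ.filter (· ≠ B.col u)).image Y
  have hG : ∀ u, A.Prescribable (B.col u) (G u) := fun u =>
    prescribable_image (by omega) (le_trans (Nat.mul_le_mul_right e (by omega)) hke) hYc hY _
  have hGT : ∀ (s : X) u, B.col u = s.1.2 → ∀ L ∈ G u, ∀ x ∈ T s, x ∉ L := by
    intro s u hu L hL x hx
    obtain ⟨i, hi, rfl⟩ := Finset.mem_image.1 hL
    exact hT s i (by simpa [hu] using hi) x hx
  let F : X → B.V → Finset (Finset A.V) := fun s u =>
    if B.col u = s.1.2 then insert (T s) (G u) else G u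
  have hF : ∀ s u, A.Prescribable (B.col u) (F s u) := by
    intro s u
    by_cases hu : B.col u = s.1.2
    · simp only [F, if_pos hu]
      refine ⟨?_, ?_, ?_, ?_⟩
      · simp only [Finset.forall_mem_insert]
        refine ⟨?_, (hG u).card_eq⟩
        rw [Finset.card_insert_of_notMem fun h => s.2.1 _ (Finset.mem_of_mem_erase h),
          Finset.card_erase_of_mem (hy _), hYc]
        omega
      · simp only [Finset.forall_mem_insert]
        exact ⟨⟨s.1.1, by simp [T], by rw [hu]; exact s.2.2.symm⟩, (hG u).not_mono⟩
      · intro x L hL L' hL' hx hx'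
        rcases Finset.mem_insert.1 hL with rfl | hL <;>
        rcases Finset.mem_insert.1 hL' with rfl | hL'
        · rfl
        · exact absurd hx' (hGT s u hu L' hL' x hx)
        · exact absurd hx (hGT s u hu L hL x hx')
        · exact (hG u).unique x L hL L' hL' hx hx'
      · refine (Nat.mul_le_mul_right e ((Finset.card_insert_le _ _).trans ?_)).trans hke
        exact Nat.succ_le_succ (Finset.card_image_le.trans
          ((Finset.card_le_univ _).trans (by simp)))
    · simpa only [F, if_neg hu] using hG u
  have hGF : ∀ s u, G u ⊆ F s u := by
    intro s u
    by_cases hu : B.col u = s.1.2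
    · simp only [F, if_pos hu]
      exact Finset.subset_insert _ _
    · simp only [F, if_neg hu]
      exact subset_rfl
  obtain ⟨A', ι, hι, hblock, hcover⟩ :=
    exists_extension_finset hk he A B (Finset.univ : Finset X) F hF
  refine ⟨A', hι.notFewer hA, fun g hg => ?_⟩
  obtain ⟨p, hp⟩ := hf _ (hι.weak_comp hg)
  refine ⟨p, ?_⟩
  have hnew : ∀ s (j : B.V → A'.V), Avoids ι (F s) j → ∀ u, g (j u) = p (B.col u) := by
    intro s j hav u
    apply eq_of_forall_ne
    intro l hl hul
    obtain ⟨a, ha, h⟩ := hav hg u (Y l)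
      (hGF s u (Finset.mem_image_of_mem _ (by simpa using hl)))
    exact h (by rw [hul]; exact hp l a ha)
  intro x
  rcases hcover x with ⟨a, rfl⟩ | ⟨s, -, j, hj, hav, u, rfl⟩
  · rw [hι.col_comp]
    by_cases haY : ∃ i, a ∈ Y i
    · obtain ⟨i, hi⟩ := haY
      rw [hY i a hi]
      exact hp i a hi
    · push Not at haY
      apply eq_of_forall_ne
      intro l hl hal
      obtain ⟨j, hj, hav⟩ := hblock ⟨(a, l), haY, hl⟩ (Finset.mem_univ _)
      obtain ⟨u, hu⟩ := hB.surjective (f := B.col) (fun _ _ h => B.col_weak h) l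
      obtain ⟨b, hb, h⟩ := hav hg u (T ⟨(a, l), haY, hl⟩) (by simp [F, hu])
      rw [hnew _ j hav u, hu] at h
      rcases Finset.mem_insert.1 hb with rfl | hb
      · exact h hal
      · exact h (hp l b (Finset.mem_of_mem_erase hb))
  · rw [hj.col_comp, hnew s j hav u]

/-- An equitably coloured `EStarSystem` as a `ColouredSystem`. -/
def ofEStarSystem {n : ℕ} (sys : EStarSystem n e) (hn : 2 * e ∣ n) (c : Fin n → Fin k)
    (hc : IsWeakColouring sys c) (m : ℕ) (hm : ∀ i, classCard c i = m) : ColouredSystem e k where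
  V := Fin n
  star v := {L | ∃ S ∈ sys.stars, S.centre = v ∧ S.leaves = L}
  card_star := by
    rintro v L ⟨S, -, -, rfl⟩
    exact S.card_leaves
  centre_notMem := by
    rintro v L ⟨S, -, rfl, rfl⟩
    exact S.centre_not_leaf
  cover := by
    intro x y hxy
    obtain ⟨S, ⟨hS, h⟩, -⟩ := sys.partition s(x, y) (by simpa using hxy)
    obtain ⟨a, ha, h⟩ := Finset.mem_image.1 h
    rcases Sym2.eq_iff.1 h with ⟨h1, h2⟩ | ⟨h1, h2⟩
    · exact .inl ⟨_, ⟨S, hS, h1, rfl⟩, h2 ▸ ha⟩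
    · exact .inr ⟨_, ⟨S, hS, h1, rfl⟩, h2 ▸ ha⟩
  star_unique := by
    rintro x y L L' ⟨S, hS, rfl, rfl⟩ ⟨S', hS', hSS', rfl⟩ hy hy'
    have hxy : S.centre ≠ y := fun h => S.centre_not_leaf (h ▸ hy)
    rw [(sys.partition s(S.centre, y) (by simpa using hxy)).unique
      ⟨hS, Finset.mem_image.2 ⟨y, hy, rfl⟩⟩ ⟨hS', Finset.mem_image.2 ⟨y, hy', by rw [hSS']⟩⟩]
  star_asymm := by
    rintro x y L L' ⟨S, hS, rfl, rfl⟩ hy ⟨S', hS', rfl, rfl⟩ hx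
    have hxy : S.centre ≠ S'.centre := fun h => S.centre_not_leaf (h ▸ hy)
    have := (sys.partition s(S.centre, S'.centre) (by simpa using hxy)).unique
      ⟨hS, Finset.mem_image.2 ⟨_, hy, rfl⟩⟩ ⟨hS', Finset.mem_image.2 ⟨_, hx, Sym2.eq_swap⟩⟩
    exact hxy (by rw [this])
  col := c
  col_weak := by
    rintro v L ⟨S, hS, rfl, rfl⟩
    exact hc S hS
  classSize := m
  card_class := hm
  dvd_card := by simpa using hn

instance {n : ℕ} : Finite (EStar n e) :=
  Finite.of_injective (fun S => (S.centre, S.leaves)) (by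
    rintro ⟨c, L, _, _⟩ ⟨c', L', _, _⟩ h
    simpa using h)

/-- A `ColouredSystem` transported to the vertex set `Fin n`. -/
noncomputable def toEStarSystem (A : ColouredSystem e k) {n : ℕ} (φ : A.V ≃ Fin n) :
    EStarSystem n e where
  stars := (Set.toFinite {S : EStar n e |
    S.leaves.map φ.symm.toEmbedding ∈ A.star (φ.symm S.centre)}).toFinset
  partition := by
    have hex : ∀ x y : Fin n, ∀ L ∈ A.star (φ.symm x), φ.symm y ∈ L → ∃ S : EStar n e,
        S.leaves.map φ.symm.toEmbedding ∈ A.star (φ.symm S.centre) ∧ s(x, y) ∈ S.edges := by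
      intro x y L hL hy
      refine ⟨⟨x, L.map φ.toEmbedding, by simpa using A.card_star hL, fun h => ?_⟩, ?_, ?_⟩
      · obtain ⟨z, hz, rfl⟩ := Finset.mem_map.1 h
        exact A.centre_notMem hL (by simpa using hz)
      · simpa [Finset.map_map] using hL
      · exact Finset.mem_image.2 ⟨y, Finset.mem_map.2 ⟨_, hy, by simp⟩, rfl⟩
    intro q
    induction q using Sym2.ind with | _ x y
    intro hxy
    simp only [Set.Finite.mem_toFinset, Set.mem_ofPred_eq]
    have hne : φ.symm x ≠ φ.symm y := by simpa using hxy
    apply existsUnique_of_exists_of_unique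
    · rcases A.cover hne with ⟨L, hL, h⟩ | ⟨L, hL, h⟩
      · exact hex x y L hL h
      · rw [Sym2.eq_swap]
        exact hex y x L hL h
    · rintro ⟨c, L, hc, hcL⟩ ⟨c', L', hc', hcL'⟩ ⟨hS, h⟩ ⟨hS', h'⟩
      obtain ⟨a, ha, h⟩ := Finset.mem_image.1 h
      obtain ⟨b, hb, h'⟩ := Finset.mem_image.1 h'
      dsimp only at *
      have ha' : φ.symm a ∈ L.map φ.symm.toEmbedding := Finset.mem_map_of_mem _ ha
      have hb' : φ.symm b ∈ L'.map φ.symm.toEmbedding := Finset.mem_map_of_mem _ hb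
      rcases Sym2.eq_iff.1 (h.trans h'.symm) with ⟨rfl, rfl⟩ | ⟨rfl, rfl⟩
      · have := A.star_unique hS hS' ha' hb'
        simpa using this
      · exact absurd hb' (A.star_asymm hS ha' hS')

lemma isWeakColouring_toEStarSystem_iff (A : ColouredSystem e k) {n l : ℕ} (φ : A.V ≃ Fin n)
    (f : Fin n → Fin l) : IsWeakColouring (A.toEStarSystem φ) f ↔ A.Weak (f ∘ φ) := by
  simp only [IsWeakColouring, toEStarSystem, Set.Finite.mem_toFinset, Set.mem_ofPred_eq]
  constructor
  · intro h v L hL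
    obtain ⟨a, ha, hav⟩ := h ⟨φ v, L.map φ.toEmbedding, by simpa using A.card_star hL,
      by simpa using A.centre_notMem hL⟩ (by simpa [Finset.map_map] using hL)
    obtain ⟨b, hb, rfl⟩ := Finset.mem_map.1 ha
    exact ⟨b, hb, hav⟩
  · intro h S hS
    obtain ⟨a, ha, hav⟩ := h hS
    obtain ⟨b, hb, rfl⟩ := Finset.mem_map.1 ha
    exact ⟨b, hb, by simpa using hav⟩

end ColouredSystem

/-- From a strongly equitable `k`-chromatic `e`-star system of order `≡ 0 (mod 2e)`,
one obtains a strongly equitable uniquely `k`-chromatic `e`-star system of some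
order `≡ 0 (mod 2e)`. -/
theorem stmt17 (k e n₀ : ℕ) (hk : 3 ≤ k) (he : 3 ≤ e) (hmod : n₀ % (2 * e) = 0)
    (sys : EStarSystem n₀ e) (hchr : Chromatic sys k)
    (hc : ∃ c : Fin n₀ → Fin k, IsWeakColouring sys c ∧
      ∀ i j : Fin k, classCard c i = classCard c j) :
    ∃ n : ℕ, n % (2 * e) = 0 ∧
      ∃ sys' : EStarSystem n e, Chromatic sys' k ∧ UniquelyColourable sys' k ∧
        ∃ c' : Fin n → Fin k, IsWeakColouring sys' c' ∧
          ∀ i j : Fin k, classCard c' i = classCard c' j := by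
  obtain ⟨c, hcw, hceq⟩ := hc
  let B := ColouredSystem.ofEStarSystem sys (Nat.dvd_of_mod_eq_zero hmod) c hcw
    (classCard c ⟨0, by omega⟩) (fun i => hceq _ _)
  have hB : B.NotFewer := fun f hf =>
    hchr.2 ⟨f, fun S hS => hf (v := S.centre) ⟨S, hS, rfl, rfl⟩⟩
  obtain ⟨B', hB', hsize⟩ := exists_classSize_ge hk he hB (k * (k * e) * e)
  obtain ⟨A, hA, hrigid⟩ := exists_rigid he hk hB' hsize
  let φ := Fintype.equivFin A.V
  have hcol : IsWeakColouring (A.toEStarSystem φ) (A.col ∘ φ.symm) := by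
    rw [isWeakColouring_toEStarSystem_iff]
    intro v L hL
    simpa using A.col_weak hL
  refine ⟨Fintype.card A.V, Nat.mod_eq_zero_of_dvd A.dvd_card, A.toEStarSystem φ,
    ⟨⟨_, hcol⟩, ?_⟩, ?_, _, hcol, ?_⟩
  · rintro ⟨f, hf⟩
    exact hA _ ((isWeakColouring_toEStarSystem_iff A φ f).1 hf)
  · intro f₁ f₂ h₁ h₂
    obtain ⟨p₁, hp₁⟩ := hrigid _ ((isWeakColouring_toEStarSystem_iff A φ f₁).1 h₁)
    obtain ⟨p₂, hp₂⟩ := hrigid _ ((isWeakColouring_toEStarSystem_iff A φ f₂).1 h₂)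
    refine ⟨p₁.symm.trans p₂, funext fun x => ?_⟩
    have h1 := hp₁ (φ.symm x)
    have h2 := hp₂ (φ.symm x)
    simp only [Function.comp_apply, Equiv.apply_symm_apply] at h1 h2
    simp [h1, h2]
  · have hclass : ∀ i, classCard (A.col ∘ φ.symm) i = A.classSize := by
      intro i
      rw [← A.card_class i]
      exact Finset.card_equiv φ.symm (by simp)
    intro i j
    rw [hclass, hclass]
end
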